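/- (Structure of residual deep self-attention.) Define C(L) := (3^L − 1)/2. For any depth L ≥ 1 and weights Θ of the depth-L residual self-attention network (with x^{l+1,j} := x^{l,j} + y^{l,j}), there exist natural numbers n_j ≥ 0 for j ∈ [C(L)] and matrices A^{(c,h,j,α)}, B^{(c,h,j,α)} ∈ ℝ^{d_a×d_x} (for j ∈ [C(L)], α ∈ [n_j], h ∈ [H]^j, 0 ≤ c ≤ j) such that for all X ∈ ℝ^{d_x×N}, the output matrix satisfies Y^{L,d_x,H,Θ}(X) = X + Σ_{j=1}^{C(L)} Σ_{α=1}^{n_j} Σ_{h ∈ [H]^j} B^{(0,h,j,α)T} M^{(1,h,j,α)} ⋯ M^{(j,h,j,α)} A^{(0,h,j,α)} X, where M^{(c,h,j,α)} := A^{(c,h,j,α)} X X^T B^{(c,h,j,α)T}. -/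

import Mathlib

open scoped BigOperators
open MeasureTheory Matrix

set_option synthInstance.maxSize 4000

/-- Per-head weights `(W^K, W^Q, W^V, W^O)`, stored as plain arrays of reals so that the
weight space carries its natural (Lebesgue) `MeasureSpace` structure. -/
abbrev HeadWeights (da dx : ℕ) : Type :=
  (Fin da → Fin dx → ℝ) × (Fin da → Fin dx → ℝ) ×
  (Fin da → Fin dx → ℝ) × (Fin dx → Fin da → ℝ)

/-- The weight configuration Θ of a depth-`L`, `H`-headed self-attention network,
a point of `ℝ^{4·L·H·d_a·d_x}` (carrying Lebesgue measure `volume`). -/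
abbrev SAWeights (L H da dx : ℕ) : Type := Fin L → Fin H → HeadWeights da dx

/-- A single (multi-headed) self-attention layer:
`y^i = Σ_{j=1}^N Σ_{h=1}^H ⟨W^{Q,h} x^i, W^{K,h} x^j⟩ W^{O,h} W^{V,h} x^j`. -/
noncomputable def saLayer {N H da dx : ℕ} (W : Fin H → HeadWeights da dx)
    (x : Fin N → Fin dx → ℝ) : Fin N → Fin dx → ℝ := fun i =>
  ∑ j : Fin N, ∑ h : Fin H,
    (∑ a : Fin da, (Matrix.of (W h).2.1).mulVec (x i) a * (Matrix.of (W h).1).mulVec (x j) a) •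
      (Matrix.of (W h).2.2.2).mulVec ((Matrix.of (W h).2.2.1).mulVec (x j))

/-- `l`-fold composition of self-attention layers. -/
noncomputable def saNetAux {N H da dx : ℕ} (W : ℕ → Fin H → HeadWeights da dx) :
    ℕ → (Fin N → Fin dx → ℝ) → (Fin N → Fin dx → ℝ)
  | 0, x => x
  | (l + 1), x => saLayer (W l) (saNetAux W l x)

noncomputable def extendW {L H da dx : ℕ} (Θ : SAWeights L H da dx) :
    ℕ → Fin H → HeadWeights da dx := fun l =>
  if h : l < L then Θ ⟨l, h⟩ else fun _ => 0

/-- `y_p^{i,L,d_x,H,Θ}` : the `p`-th coordinate of the depth-`L` self-attention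
network output at position `i`, as a scalar function of the `N` inputs. -/
noncomputable def saOutput {H da dx : ℕ} (L N : ℕ) (Θ : SAWeights L H da dx)
    (i : Fin N) (p : Fin dx) (x : Fin N → Fin dx → ℝ) : ℝ :=
  saNetAux (extendW Θ) L x i p

/-- `f` depends only on the input vectors at positions in `A`. -/
def DependsOnlyOn {N dx : ℕ} (f : (Fin N → Fin dx → ℝ) → ℝ) (A : Finset (Fin N)) : Prop :=
  ∀ x y : Fin N → Fin dx → ℝ, (∀ j ∈ A, x j = y j) → f x = f y

/-- The separation rank of `f : (ℝ^{d_x})^N → ℝ` w.r.t. the partition `(A,B)`: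
the minimal number `R` of summands, each a product of a function of the inputs indexed
by `A` with a function of the inputs indexed by `B`, summing up to `f` (`⊤` if no
finite such decomposition exists). -/
noncomputable def sepRank {N dx : ℕ} (f : (Fin N → Fin dx → ℝ) → ℝ)
    (A B : Finset (Fin N)) : ℕ∞ :=
  sInf {R : ℕ∞ | ∃ n : ℕ, R = (n : ℕ∞) ∧
    ∃ g g' : Fin n → ((Fin N → Fin dx → ℝ) → ℝ),
      (∀ r, DependsOnlyOn (g r) A) ∧ (∀ r, DependsOnlyOn (g' r) B) ∧
      ∀ x, f x = ∑ r : Fin n, g r x * g' r x}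

/-- `l`-fold composition of self-attention layers with residual (skip) connections:
each layer's output is its input plus the self-attention computation. -/
noncomputable def saResAux {N H da dx : ℕ} (W : ℕ → Fin H → HeadWeights da dx) :
    ℕ → (Fin N → Fin dx → ℝ) → (Fin N → Fin dx → ℝ)
  | 0, x => x
  | (l + 1), x => saResAux W l x + saLayer (W l) (saResAux W l x)

/-- The `p`-th coordinate of the depth-`L` *residual* self-attention network output at
position `i`. -/
noncomputable def saResOutput {H da dx : ℕ} (L N : ℕ) (Θ : SAWeights L H da dx)
    (i : Fin N) (p : Fin dx) (x : Fin N → Fin dx → ℝ) : ℝ :=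
  saResAux (extendW Θ) L x i p

/-- `C(L) = (3^L − 1)/2`. -/
def CL (L : ℕ) : ℕ := (3 ^ L - 1) / 2

/-- The output matrix `Y^{L,d_x,H,Θ}(X) ∈ ℝ^{d_x×N}` of the depth-`L` *residual* network,
whose `j`-th column is the network output at position `j`, on input `X ∈ ℝ^{d_x×N}`. -/
noncomputable def saResMatrix {H da dx : ℕ} (L N : ℕ) (Θ : SAWeights L H da dx)
    (X : Matrix (Fin dx) (Fin N) ℝ) : Matrix (Fin dx) (Fin N) ℝ :=
  Matrix.of fun p j => saResAux (extendW Θ) L (fun j' p' => X p' j') j p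

/-- The Gram map `X ↦ X Xᵀ`. -/
def gramMap (dx N : ℕ) : Matrix (Fin dx) (Fin N) ℝ → Matrix (Fin dx) (Fin dx) ℝ :=
  fun X => X * Xᵀ

/-- `IsGramChain da j f` says that `f X = E₀ (X Xᵀ) E₁ (X Xᵀ) ⋯ (X Xᵀ) Eⱼ` for constant matrices
`Eᵢ = Uᵢᵀ Vᵢ` that factor through `ℝ^da`. -/
inductive IsGramChain {dx N : ℕ} (da : ℕ) :
    ℕ → (Matrix (Fin dx) (Fin N) ℝ → Matrix (Fin dx) (Fin dx) ℝ) → Prop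
  | const (U V : Matrix (Fin da) (Fin dx) ℝ) : IsGramChain da 0 (fun _ => Uᵀ * V)
  | step (U V : Matrix (Fin da) (Fin dx) ℝ) {j : ℕ}
      {f : Matrix (Fin dx) (Fin N) ℝ → Matrix (Fin dx) (Fin dx) ℝ} (hf : IsGramChain da j f) :
      IsGramChain da (j + 1) ((fun _ => Uᵀ * V) * gramMap dx N * f)

namespace IsGramChain

variable {dx N da i j : ℕ} {f g : Matrix (Fin dx) (Fin N) ℝ → Matrix (Fin dx) (Fin dx) ℝ}

theorem const_mul (U V : Matrix (Fin da) (Fin dx) ℝ) (hg : IsGramChain da j g) :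
    IsGramChain da j ((fun _ => Uᵀ * V) * g) := by
  cases hg with
  | const U' V' =>
    convert const (N := N) U (V * U'ᵀ * V') using 1
    funext X
    simp [Matrix.mul_assoc]
  | step U' V' hf =>
    convert step U (V * U'ᵀ * V') hf using 1
    funext X
    simp [Matrix.mul_assoc]

theorem mul (hf : IsGramChain da i f) (hg : IsGramChain da j g) : IsGramChain da (i + j) (f * g) := by
  induction hf with
  | const U V => simpa using hg.const_mul U V
  | step U V _ ih =>
    rw [Nat.add_right_comm, mul_assoc]
    exact step U V ih

theorem mul_gramMap_mul (hf : IsGramChain da i f) (hg : IsGramChain da j g) :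
    IsGramChain da (i + j + 1) (f * gramMap dx N * g) := by
  induction hf with
  | const U V => simpa using step U V hg
  | step U V _ ih =>
    rw [Nat.add_right_comm _ 1, mul_assoc _ _ (gramMap dx N), mul_assoc]
    exact step U V ih

theorem transpose (hf : IsGramChain da j f) : IsGramChain da j (fun X => (f X)ᵀ) := by
  induction hf with
  | const U V =>
    convert const (N := N) V U using 1
    funext X
    simp
  | step U V _ ih =>
    convert ih.mul_gramMap_mul (const V U) using 1
    funext X
    simp [gramMap, Matrix.mul_assoc]

/-- A chain in the form `B₀ᵀ M₁ ⋯ Mⱼ A₀` with `M_c = A_c X Xᵀ B_cᵀ`. -/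
theorem exists_factors (hf : IsGramChain da j f) :
    ∃ A B : ℕ → Matrix (Fin da) (Fin dx) ℝ, ∀ X, f X =
      (B 0)ᵀ * ((List.finRange j).map
        (fun c => A (c.val + 1) * X * Xᵀ * (B (c.val + 1))ᵀ)).prod * A 0 := by
  induction hf with
  | const U V => exact ⟨fun _ => V, fun _ => U, fun X => by simp⟩
  | step U V _ ih =>
    obtain ⟨A, B, h⟩ := ih
    refine ⟨fun | 0 => A 0 | 1 => V | n + 2 => A (n + 1), fun | 0 => U | n + 1 => B n, ?_⟩
    intro X
    simp [gramMap, h, List.finRange_succ, Function.comp_def, Matrix.mul_assoc]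

end IsGramChain

/-- Finite sums of chains whose lengths lie in `[a, b]`. -/
def chainSums (dx N da a b : ℕ) :
    AddSubmonoid (Matrix (Fin dx) (Fin N) ℝ → Matrix (Fin dx) (Fin dx) ℝ) :=
  AddSubmonoid.closure {f | ∃ j, a ≤ j ∧ j ≤ b ∧ IsGramChain da j f}

section chainSums

variable {dx N da a b c d : ℕ} {f g : Matrix (Fin dx) (Fin N) ℝ → Matrix (Fin dx) (Fin dx) ℝ}

theorem chainSums_mono (hca : c ≤ a) (hbd : b ≤ d) :
    chainSums dx N da a b ≤ chainSums dx N da c d :=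
  AddSubmonoid.closure_mono fun _ ⟨j, h₁, h₂, h⟩ => ⟨j, hca.trans h₁, h₂.trans hbd, h⟩

theorem const_mem_chainSums (U V : Matrix (Fin da) (Fin dx) ℝ) :
    (fun _ => Uᵀ * V) ∈ chainSums dx N da 0 0 :=
  AddSubmonoid.subset_closure ⟨0, le_rfl, le_rfl, .const U V⟩

theorem mul_mem_chainSums (hf : f ∈ chainSums dx N da a b) (hg : g ∈ chainSums dx N da c d) :
    f * g ∈ chainSums dx N da (a + c) (b + d) := by
  induction hf using AddSubmonoid.closure_induction with
  | mem f hf =>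
    obtain ⟨i, hi₁, hi₂, hf⟩ := hf
    induction hg using AddSubmonoid.closure_induction with
    | mem g hg =>
      obtain ⟨j, hj₁, hj₂, hg⟩ := hg
      exact AddSubmonoid.subset_closure ⟨i + j, by omega, by omega, hf.mul hg⟩
    | zero => simp
    | add _ _ _ _ h₁ h₂ => rw [mul_add]; exact add_mem h₁ h₂
  | zero => simp
  | add _ _ _ _ h₁ h₂ => rw [add_mul]; exact add_mem h₁ h₂

theorem mul_gramMap_mul_mem_chainSums (hf : f ∈ chainSums dx N da a b)
    (hg : g ∈ chainSums dx N da c d) :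
    f * gramMap dx N * g ∈ chainSums dx N da (a + c + 1) (b + d + 1) := by
  induction hf using AddSubmonoid.closure_induction with
  | mem f hf =>
    obtain ⟨i, hi₁, hi₂, hf⟩ := hf
    induction hg using AddSubmonoid.closure_induction with
    | mem g hg =>
      obtain ⟨j, hj₁, hj₂, hg⟩ := hg
      exact AddSubmonoid.subset_closure ⟨i + j + 1, by omega, by omega, hf.mul_gramMap_mul hg⟩
    | zero => simp
    | add _ _ _ _ h₁ h₂ => rw [mul_add]; exact add_mem h₁ h₂
  | zero => simp
  | add _ _ _ _ h₁ h₂ => rw [add_mul, add_mul]; exact add_mem h₁ h₂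

theorem transpose_mem_chainSums (hf : f ∈ chainSums dx N da a b) :
    (fun X => (f X)ᵀ) ∈ chainSums dx N da a b := by
  induction hf using AddSubmonoid.closure_induction with
  | mem f hf =>
    obtain ⟨j, h₁, h₂, hf⟩ := hf
    exact AddSubmonoid.subset_closure ⟨j, h₁, h₂, hf.transpose⟩
  | zero => simp only [Pi.zero_apply, Matrix.transpose_zero]; exact zero_mem (chainSums dx N da a b)
  | add f g _ _ h₁ h₂ => simpa [Pi.add_def] using add_mem h₁ h₂

/-- If `f` is a sum of chains, then the product of `1 + f` with a constant matrix of the form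
`Uᵀ V` on the left is one too. -/
theorem const_mul_one_add_mem_chainSums (U V : Matrix (Fin da) (Fin dx) ℝ)
    (hf : f ∈ chainSums dx N da a b) :
    (fun _ => Uᵀ * V) * (1 + f) ∈ chainSums dx N da 0 b := by
  rw [mul_add, mul_one]
  refine add_mem (chainSums_mono le_rfl (Nat.zero_le b) (const_mem_chainSums U V)) ?_
  exact chainSums_mono (Nat.zero_le _) (by omega)
    (mul_mem_chainSums (const_mem_chainSums U V) hf)

/-- Sums of chains of lengths in `[1, C]` in the fully indexed form. -/
theorem exists_indexed_of_mem_chainSums {C H : ℕ} (h₀ : Fin H)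
    (hf : f ∈ chainSums dx N da 1 C) :
    ∃ (n : Fin C → ℕ)
      (A B : (j : Fin C) → Fin (n j) → (Fin (j.val + 1) → Fin H) →
        Fin (j.val + 2) → Matrix (Fin da) (Fin dx) ℝ),
      ∀ X : Matrix (Fin dx) (Fin N) ℝ,
        f X = ∑ j : Fin C, ∑ α : Fin (n j), ∑ h : Fin (j.val + 1) → Fin H,
            (B j α h 0)ᵀ *
              (((List.finRange (j.val + 1)).map
                  (fun c => A j α h c.succ * X * Xᵀ * (B j α h c.succ)ᵀ)).prod) *
              (A j α h 0) := by
  induction hf using AddSubmonoid.closure_induction with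
  | mem f hf =>
    obtain ⟨j, h₁, h₂, hf⟩ := hf
    obtain ⟨k, rfl⟩ : ∃ k, j = k + 1 := ⟨j - 1, by omega⟩
    obtain ⟨A, B, h⟩ := hf.exists_factors
    refine ⟨fun _ => 1, fun _ _ _ c => A c.val,
      fun j _ h c => if j.val = k ∧ h = fun _ => h₀ then B c.val else 0, fun X => ?_⟩
    rw [Finset.sum_eq_single_of_mem (⟨k, h₂⟩ : Fin C) (Finset.mem_univ _),
      Fin.sum_univ_one,
      Finset.sum_eq_single_of_mem (fun _ => h₀) (Finset.mem_univ _)]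
    · simp [h]
    · intro h' _ hne
      simp [hne]
    · intro j _ hne
      have : j.val ≠ k := fun e => hne (Fin.ext e)
      simp [this]
  | zero => exact ⟨fun _ => 0, fun _ α => α.elim0, fun _ α => α.elim0, fun X => by simp⟩
  | add f g _ _ hf hg =>
    obtain ⟨n₁, A₁, B₁, h₁⟩ := hf
    obtain ⟨n₂, A₂, B₂, h₂⟩ := hg
    refine ⟨fun j => n₁ j + n₂ j, fun j => Fin.addCases (A₁ j) (A₂ j),
      fun j => Fin.addCases (B₁ j) (B₂ j), fun X => ?_⟩
    simp only [Pi.add_apply, h₁, h₂, Fin.sum_univ_add, Fin.addCases_left, Fin.addCases_right,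
      Finset.sum_add_distrib]

end chainSums

theorem CL_succ (l : ℕ) : CL (l + 1) = 3 * CL l + 1 := by
  have hodd : 3 ^ l % 2 = 1 := by simp [Nat.pow_mod]
  unfold CL
  rw [pow_succ]
  omega

/-- A self-attention layer in matrix form. -/
theorem saLayer_eq_matrix {N H da dx : ℕ} (W : Fin H → HeadWeights da dx)
    (Y : Matrix (Fin dx) (Fin N) ℝ) :
    (Matrix.of fun p i => saLayer W (fun j q => Y q j) i p) =
      ∑ h, (Matrix.of (W h).2.2.2 * (Matrix.of (W h).2.2.1 * Y)) *
        ((Matrix.of (W h).1 * Y)ᵀ * (Matrix.of (W h).2.1 * Y)) := by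
  ext p i
  simp only [saLayer, Matrix.of_apply, Finset.sum_apply, Matrix.sum_apply, Pi.smul_apply,
    smul_eq_mul]
  rw [Finset.sum_comm]
  refine Finset.sum_congr rfl fun h _ => ?_
  rw [Matrix.mul_apply]
  refine Finset.sum_congr rfl fun j _ => ?_
  rw [mul_comm, Matrix.mul_apply (M := (_ : Matrix _ _ ℝ)ᵀ)]
  refine congrArg₂ _ rfl (Finset.sum_congr rfl fun a _ => mul_comm _ _)

/-- The depth-`l` residual network acts as `X ↦ (1 + f X) X` with `f` a sum of chains of lengths
between `1` and `C(l)`. -/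
theorem exists_chainSums_saResAux {H da dx : ℕ} (N : ℕ) (W : ℕ → Fin H → HeadWeights da dx)
    (l : ℕ) :
    ∃ f ∈ chainSums dx N da 1 (CL l), ∀ X : Matrix (Fin dx) (Fin N) ℝ,
      (Matrix.of fun p i => saResAux W l (fun j q => X q j) i p) = (1 + f X) * X := by
  induction l with
  | zero => exact ⟨0, zero_mem _, fun X => by ext; simp [saResAux]⟩
  | succ l ih =>
    obtain ⟨f, hf, hX⟩ := ih
    let left (h : Fin H) : Matrix (Fin dx) (Fin N) ℝ → Matrix (Fin dx) (Fin dx) ℝ :=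
      (fun _ => (Matrix.of (W l h).2.2.2)ᵀᵀ * Matrix.of (W l h).2.2.1) * (1 + f)
    let key (h : Fin H) : Matrix (Fin dx) (Fin N) ℝ → Matrix (Fin dx) (Fin dx) ℝ :=
      (1 + fun X => (f X)ᵀ) *
        ((fun _ => (Matrix.of (W l h).1)ᵀ * Matrix.of (W l h).2.1) * (1 + f))
    have hleft (h : Fin H) : left h ∈ chainSums dx N da 0 (CL l) :=
      const_mul_one_add_mem_chainSums _ _ hf
    have hkey (h : Fin H) : key h ∈ chainSums dx N da 0 (CL l + CL l) := by
      have hr := const_mul_one_add_mem_chainSums (Matrix.of (W l h).1) (Matrix.of (W l h).2.1) hf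
      simp only [key, add_mul, one_mul]
      exact add_mem (chainSums_mono le_rfl (by omega) hr)
        (chainSums_mono (by omega) le_rfl (mul_mem_chainSums (transpose_mem_chainSums hf) hr))
    refine ⟨f + ∑ h, left h * gramMap dx N * key h, ?_, fun X => ?_⟩
    · rw [CL_succ]
      refine add_mem (chainSums_mono le_rfl (by omega) hf) (sum_mem fun h _ => ?_)
      exact chainSums_mono (by omega) (by omega)
        (mul_gramMap_mul_mem_chainSums (hleft h) (hkey h))
    · have hlayer := saLayer_eq_matrix (W l)
        (Matrix.of fun p i => saResAux W l (fun j q => X q j) i p)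
      have hsplit : (Matrix.of fun p i => saResAux W (l + 1) (fun j q => X q j) i p) =
          (Matrix.of fun p i => saResAux W l (fun j q => X q j) i p) +
            Matrix.of fun p i => saLayer (W l) (saResAux W l (fun j q => X q j)) i p := rfl
      rw [hsplit]
      refine (congrArg _ hlayer).trans ?_
      rw [hX]
      simp only [Pi.add_apply, Finset.sum_apply, ← add_assoc]
      rw [Matrix.add_mul (1 + f X), Matrix.sum_mul]
      refine congrArg _ (Finset.sum_congr rfl fun h _ => ?_)
      simp [left, key, gramMap, Matrix.mul_assoc]

/-- Lemma 6 of the paper, structure of residual deep self-attention: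
the residual network output can be written as
`Y(X) = X + Σ_{j=1}^{C(L)} Σ_{α=1}^{n_j} Σ_{h∈[H]^j}
  B^{(0,h,j,α)ᵀ} M^{(1,h,j,α)} ⋯ M^{(j,h,j,α)} A^{(0,h,j,α)} X`,
with `M^{(c,h,j,α)} = A^{(c,h,j,α)} X Xᵀ B^{(c,h,j,α)ᵀ}` (the index `j ∈ [C(L)]` is
represented by `j : Fin (CL L)` standing for the chain length `j.val + 1 ∈ {1,…,C(L)}`). -/
theorem sa_residual_network_structure
    {L H da dx : ℕ} (hL : 1 ≤ L) (hdxda : dx = H * da) (N : ℕ)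
    (Θ : SAWeights L H da dx) :
    ∃ (n : Fin (CL L) → ℕ)
      (A B : (j : Fin (CL L)) → Fin (n j) → (Fin (j.val + 1) → Fin H) →
        Fin (j.val + 2) → Matrix (Fin da) (Fin dx) ℝ),
      ∀ X : Matrix (Fin dx) (Fin N) ℝ,
        saResMatrix L N Θ X =
          X + ∑ j : Fin (CL L), ∑ α : Fin (n j), ∑ h : Fin (j.val + 1) → Fin H,
            (B j α h 0)ᵀ *
              (((List.finRange (j.val + 1)).map
                  (fun c => A j α h c.succ * X * Xᵀ * (B j α h c.succ)ᵀ)).prod) *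
              (A j α h 0) * X := by
  obtain ⟨f, hf, hX⟩ := exists_chainSums_saResAux N (extendW Θ) L
  rcases H.eq_zero_or_pos with rfl | hH
  · obtain rfl : dx = 0 := by simpa using hdxda
    exact ⟨fun _ => 0, fun _ α => α.elim0, fun _ α => α.elim0, fun X => Subsingleton.elim _ _⟩
  · obtain ⟨n, A, B, h⟩ := exists_indexed_of_mem_chainSums ⟨0, hH⟩ hf
    refine ⟨n, A, B, fun X => (hX X).trans ?_⟩
    rw [Matrix.add_mul, Matrix.one_mul, h X]
    simp only [Matrix.sum_mul]
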